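/- The number of non-crossing partitions of {1,…,k} into exactly t blocks equals the Narayana number N(k,t) = (1/k)·C(k,t)·C(k,t-1). -/

import Mathlib

/-- A finpartition of `Fin k` is non-crossing if there are no `a < b < c < d` with
`a, c` in one block and `b, d` in a different block. -/
def IsNonCrossing {k : ℕ} (P : Finpartition (Finset.univ : Finset (Fin k))) : Prop :=
  ¬ ∃ a b c d : Fin k, a < b ∧ b < c ∧ c < d ∧
    ∃ B1 ∈ P.parts, ∃ B2 ∈ P.parts, B1 ≠ B2 ∧ a ∈ B1 ∧ c ∈ B1 ∧ b ∈ B2 ∧ d ∈ B2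

namespace NC
open Finset

/-- visible minima -/
def V (n : ℕ) (r : ℕ → ℕ) : Finset ℕ :=
  (range n).filter (fun v => r v = v ∧ ∀ i < n, v ≤ i → v ≤ r i)

/-- number of blocks -/
def blk (n : ℕ) (r : ℕ → ℕ) : ℕ := ((range n).filter (fun v => r v = v)).card

def Good (n : ℕ) (r : ℕ → ℕ) : Prop :=
  (∀ i, n ≤ i → r i = 0) ∧
    ∀ j < n, r j ≤ j ∧ r (r j) = r j ∧ ∀ i < j, r j ≤ i → r j ≤ r i

open Classical in
noncomputable def T : ℕ → Finset (ℕ → ℕ)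
  | 0 => {fun _ => 0}
  | n + 1 => (T n).biUnion
      (fun r => (insert n (V n r)).image (fun v => Function.update r n v))

theorem V_lt {n r v} (h : v ∈ V n r) : v < n := by
  simp [V] at h; exact h.1

theorem mem_T (n : ℕ) : ∀ r, r ∈ T n ↔ Good n r := by
  induction n with
  | zero =>
    intro r
    simp [T, Good, funext_iff]
  | succ n ih =>
    intro r
    simp only [T, mem_biUnion, mem_image, ih]
    constructor
    · rintro ⟨r, ⟨h0, h1⟩, v, hv, rfl⟩
      have hv' : v = n ∨ (v < n ∧ r v = v ∧ ∀ i < n, v ≤ i → v ≤ r i) := by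
        simpa [V] using hv
      have hvn : v ≤ n := by omega
      refine ⟨fun i hi => ?_, fun j hj => ?_⟩
      · rw [Function.update_of_ne (by omega)]; exact h0 i (by omega)
      · rcases Nat.lt_succ_iff_lt_or_eq.1 hj with hj | rfl
        · obtain ⟨a, b, c⟩ := h1 j hj
          rw [Function.update_of_ne (by omega), Function.update_of_ne (by omega)]
          refine ⟨a, b, fun i hi => ?_⟩
          rw [Function.update_of_ne (by omega)]
          exact c i hi
        · rw [Function.update_self]
          refine ⟨hvn, ?_, fun i hi => ?_⟩
          · by_cases h : v = j
            · subst h; simp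
            · rw [Function.update_of_ne h]; rcases hv' with h' | h' 
              · exact absurd h' h
              · exact h'.2.1
          · rw [Function.update_of_ne (by omega)]
            intro hvi
            rcases hv' with h' | h'
            · omega
            · exact h'.2.2 i hi hvi
    · rintro ⟨h0, h1⟩
      have hu : ∀ i, i < n → Function.update r n 0 i = r i := fun i hi =>
        Function.update_of_ne (by omega) _ _
      refine ⟨Function.update r n 0, ⟨fun i hi => ?_, fun j hj => ?_⟩, r n, ?_, ?_⟩
      · by_cases h : i = n
        · subst h; simp
        · rw [Function.update_of_ne h]; exact h0 i (by omega)
      · obtain ⟨a, b, c⟩ := h1 j (by omega)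
        rw [hu j hj, hu _ (by omega)]
        refine ⟨a, b, fun i hi => ?_⟩
        rw [hu i (by omega)]
        exact c i hi
      · obtain ⟨a, b, c⟩ := h1 n (by omega)
        by_cases h : r n = n
        · simp [h]
        · apply mem_insert_of_mem
          simp only [V, mem_filter, mem_range]
          refine ⟨by omega, ?_, fun i hi => ?_⟩
          · rw [hu _ (by omega)]; exact b
          · rw [hu _ hi]; exact c i hi
      · simp

theorem V_update {n r v} (hv : v ∈ insert n (V n r)) :
    V (n+1) (Function.update r n v) = insert v ((V n r).filter (· ≤ v)) := by
  have hv' : v = n ∨ (v < n ∧ r v = v ∧ ∀ i < n, v ≤ i → v ≤ r i) := by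
    simpa [V] using hv
  have hu : ∀ i, i < n → Function.update r n v i = r i := fun i hi =>
    Function.update_of_ne (by omega) _ _
  ext u
  simp only [V, mem_filter, mem_range, mem_insert]
  constructor
  · rintro ⟨a, b, c⟩
    have h1 := c n (by omega) (by omega)
    rw [Function.update_self] at h1
    by_cases h : u = v
    · exact Or.inl h
    · right
      have : u < n := by omega
      refine ⟨⟨this, ?_, fun i hi hui => ?_⟩, h1⟩
      · rw [← hu u this]; exact b
      · have := c i (by omega) hui
        rwa [hu i hi] at this
  · rintro (rfl | ⟨⟨a, b, c⟩, d⟩)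
    · refine ⟨by omega, ?_, fun i hi hui => ?_⟩
      · by_cases h : u = n
        · subst h; simp
        · rw [hu _ (by omega)]; rcases hv' with h' | h'
          · exact absurd h' h
          · exact h'.2.1
      · by_cases h : i = n
        · subst h; simp
        · rw [hu _ (by omega)]; rcases hv' with h' | h'
          · omega
          · exact h'.2.2 i (by omega) hui
    · refine ⟨by omega, ?_, fun i hi hui => ?_⟩
      · rw [hu _ a]; exact b
      · by_cases h : i = n
        · subst h; simpa using d
        · rw [hu _ (by omega)]; exact c i (by omega) hui

theorem blk_update {n r v} (hv : v ≤ n) :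
    blk (n+1) (Function.update r n v) = blk n r + if v = n then 1 else 0 := by
  unfold blk
  rw [range_add_one, filter_insert]
  have : (range n).filter (fun x => Function.update r n v x = x)
      = (range n).filter (fun x => r x = x) := by
    apply filter_congr
    intro x hx
    rw [Function.update_of_ne (by simp at hx; omega)]
  rw [this]
  simp only [Function.update_self]
  split_ifs
  · rw [card_insert_of_notMem (by simp)]
  · rfl

theorem T_off {n r} (h : r ∈ T n) : r n = 0 := ((mem_T n r).1 h).1 n le_rfl

theorem sum_T (n : ℕ) (f : (ℕ → ℕ) → ℕ) :
    ∑ r ∈ T (n+1), f r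
      = ∑ r ∈ T n, ∑ v ∈ insert n (V n r), f (Function.update r n v) := by
  classical
  rw [T, sum_biUnion]
  · refine sum_congr rfl fun r hr => ?_
    rw [sum_image]
    intro a _ b _ hab
    simpa using congrFun hab n
  · intro r hr s hs hrs
    simp only [Function.onFun]
    rw [disjoint_left]
    intro g hg hg'
    simp only [mem_image] at hg hg'
    obtain ⟨v, _, rfl⟩ := hg
    obtain ⟨w, _, hw⟩ := hg'
    apply hrs
    funext i
    by_cases h : i = n
    · subst h; rw [T_off hr, T_off hs]
    · have := congrFun hw i
      rw [Function.update_of_ne h, Function.update_of_ne h] at this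
      exact this.symm

/-- Summing a function of rank. -/
theorem sum_rank (S : Finset ℕ) (g : ℕ → ℕ) :
    ∑ v ∈ S, g ((S.filter (· ≤ v)).card) = ∑ j ∈ Icc 1 S.card, g j := by
  induction S using Finset.induction_on_max with
  | empty => simp
  | insert a S ha ih =>
    have hn : a ∉ S := fun h => lt_irrefl _ (ha a h)
    rw [sum_insert hn, card_insert_of_notMem hn, sum_Icc_succ_top (by omega), ← ih, add_comm]
    congr 1
    · refine sum_congr rfl fun v hv => ?_
      rw [filter_insert, if_neg (by have := ha v hv; omega)]
    · rw [filter_insert, if_pos le_rfl, filter_true_of_mem (fun x hx => (ha x hx).le),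
        card_insert_of_notMem hn]

theorem sum_T' (n : ℕ) (g : ℕ → ℕ → ℕ) :
    ∑ r ∈ T (n+1), g (blk (n+1) r) (V (n+1) r).card
      = ∑ r ∈ T n, (g (blk n r + 1) ((V n r).card + 1)
        + ∑ j ∈ Icc 1 (V n r).card, g (blk n r) j) := by
  rw [sum_T]
  refine sum_congr rfl fun r hr => ?_
  have hn : n ∉ V n r := fun h => lt_irrefl _ (V_lt h)
  rw [sum_insert hn, V_update (mem_insert_self _ _), blk_update le_rfl, if_pos rfl,
    filter_true_of_mem (fun x hx => (V_lt hx).le), card_insert_of_notMem hn, ← sum_rank]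
  congr 1
  refine sum_congr rfl fun v hv => ?_
  have := V_lt hv
  rw [V_update (mem_insert_of_mem hv), blk_update (by omega), if_neg (by omega),
    insert_eq_of_mem (by simp [hv])]
  rfl

noncomputable def A (n t s : ℕ) : ℕ := ∑ r ∈ T n, if blk n r = t ∧ (V n r).card = s then 1 else 0

theorem A_succ (n t s : ℕ) : A (n+1) t s = ∑ r ∈ T n,
    ((if blk n r + 1 = t ∧ (V n r).card + 1 = s then 1 else 0)
      + if blk n r = t ∧ 1 ≤ s ∧ s ≤ (V n r).card then 1 else 0) := by
  unfold A
  rw [sum_T' n (fun a b => if a = t ∧ b = s then 1 else 0)]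
  refine sum_congr rfl fun r hr => ?_
  congr 1
  by_cases h : blk n r = t
  · simp [h]
  · simp [h]

theorem A_rec (n t s : ℕ) (hs : 1 ≤ s) :
    A (n+1) (t+1) s + A n t s = A (n+1) (t+1) (s+1) + A n (t+1) s + A n t (s-1) := by
  rw [A_succ, A_succ]
  unfold A
  simp only [← sum_add_distrib]
  refine sum_congr rfl fun r hr => ?_
  split_ifs <;> omega

theorem A_zero_t (n s : ℕ) : A (n+1) 0 s = 0 := by
  unfold A
  apply sum_eq_zero
  intro r hr
  rw [mem_T] at hr
  have : r 0 = 0 := by have := (hr.2 0 (by omega)).1; omega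
  rw [if_neg]
  rintro ⟨h, -⟩
  simp only [blk, card_eq_zero, filter_eq_empty_iff] at h
  exact h (x := 0) (by simp) this

theorem zero_mem_V {n r} (hr : r ∈ T (n+1)) : 0 ∈ V (n+1) r := by
  rw [mem_T] at hr
  have : r 0 = 0 := by have := (hr.2 0 (by omega)).1; omega
  simp [V, this]

theorem V_card_le (n r) : (V n r).card ≤ blk n r := by
  apply card_le_card
  intro v; simp only [V, mem_filter]; tauto

theorem A_gt (n t s : ℕ) (h : t < s) : A n t s = 0 := by
  unfold A
  apply sum_eq_zero
  intro r hr
  rw [if_neg]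
  have := V_card_le n r
  omega

theorem blk_le (n r) : blk n r ≤ n := by
  simpa [blk] using card_filter_le (range n) (fun v => r v = v)

theorem A_zero_s (n t : ℕ) : A (n+1) t 0 = 0 := by
  unfold A
  apply sum_eq_zero
  intro r hr
  rw [if_neg]
  rintro ⟨-, h⟩
  rw [card_eq_zero] at h
  have := zero_mem_V hr
  simp [h] at this

theorem A_big (n t s : ℕ) (h : n < t) : A n t s = 0 := by
  unfold A
  apply sum_eq_zero
  intro r hr
  rw [if_neg]
  have := blk_le n r
  omega

theorem A_one (s : ℕ) : A 1 1 s = if s = 1 then 1 else 0 := by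
  rw [A_succ]
  simp [T, V, blk]
  congr 1
  apply propext; omega

/-- total count -/
theorem total (n t : ℕ) : ((T (n+1)).filter (fun r => blk (n+1) r = t)).card = A (n+2) t 1 := by
  rw [A_succ, card_filter]
  refine sum_congr rfl fun r hr => ?_
  have : 1 ≤ (V (n+1) r).card := card_pos.2 ⟨0, zero_mem_V hr⟩
  have h : ¬ (blk (n+1) r + 1 = t ∧ (V (n+1) r).card + 1 = 1) := by omega
  rw [if_neg h]
  simp [this]


theorem A_formula (n : ℕ) : ∀ t s, s ≤ t → t ≤ n + 1 →
    (n + 1) * A (n+1) t s = s * (n+1).choose t * (n - s).choose (t - s) := by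
  induction n with
  | zero =>
    intro t s h1 h2
    rcases (by omega : t = 0 ∨ t = 1) with rfl | rfl
    · rw [A_zero_t]; simp; omega
    · rw [A_one]
      rcases (by omega : s = 0 ∨ s = 1) with rfl | rfl <;> simp
  | succ n ih =>
    intro t
    rcases t with _ | t
    · intro s h1 h2; rw [A_zero_t]; simp; omega
    · intro s h1 h2
      induction hd : t + 1 - s generalizing s with
      | zero =>
        obtain rfl : s = t + 1 := by omega
        have hr := A_rec (n+1) t (t+1) (by omega)
        rw [A_gt (n+1) t (t+1) (by omega), A_gt (n+1+1) (t+1) (t+1+1) (by omega)] at hr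
        simp only [Nat.add_sub_cancel] at hr
        have e1 := ih t t le_rfl (by omega)
        have e2 : (n + 1) * A (n+1) (t+1) (t+1) = (t+1) * (n+1).choose (t+1) := by
          by_cases h : t + 1 ≤ n + 1
          · simpa using ih (t+1) (t+1) le_rfl h
          · rw [A_big _ _ _ (by omega), Nat.choose_eq_zero_of_lt (by omega)]; simp
        have e3 := Nat.choose_succ_right_eq (n+1) t
        have e4 := Nat.add_one_mul_choose_eq (n+1) t
        obtain ⟨j, hj⟩ : ∃ j, n + 1 = t + j := ⟨n+1-t, by omega⟩
        have e5 : n + 1 - t = j := by omega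
        rw [e5] at e3
        simp only [Nat.sub_self, Nat.choose_zero_right, mul_one] at e1 ⊢
        have e6 : (n+1) * A (n+1+1) (t+1) (t+1) = (n+1) * (n+1).choose t := by
          rw [add_zero, zero_add] at hr
          rw [hr, mul_add, e1, e2, mul_comm (t+1), e3, hj]
          ring
        have e7 := Nat.eq_of_mul_eq_mul_left (by omega) e6
        rw [e7, e4, mul_comm]
      | succ d ihd =>
        rcases s with _ | u
        · rw [A_zero_s]; simp
        have e1 := ihd (u+1+1) (by omega) (by omega)
        have hr := A_rec (n+1) t (u+1) (by omega)
        rw [Nat.add_sub_cancel] at hr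
        obtain ⟨i, rfl⟩ : ∃ i, t = u + 1 + i := ⟨t - (u+1), by omega⟩
        have e2 := ih (u+1+i) (u+1) (by omega) (by omega)
        have e3 := ih (u+1+i) u (by omega) (by omega)
        obtain ⟨j, hj⟩ : ∃ j, n = u + i + j := ⟨n - u - i, by omega⟩
        subst hj
        have e4 : (u+i+j + 1) * A (u+i+j+1) (u+1+i+1) (u+1)
            = (u+1) * (u+i+j+1).choose (u+1+i+1) * (u+i+j-(u+1)).choose (i+1) := by
          by_cases h : u+1+i+1 ≤ u+i+j+1
          · have := ih (u+1+i+1) (u+1) (by omega) (by omega)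
            rwa [show u+1+i+1-(u+1) = i+1 by omega] at this
          · rw [A_big _ _ _ (by omega), Nat.choose_eq_zero_of_lt (by omega)]; simp
        rw [show u+1+i-(u+1) = i by omega] at e2
        rw [show u+1+i-u = i+1 by omega, show u+i+j-u = i+j by omega] at e3
        have hdi : d = i := by omega
        rw [hdi, show u+i+j+1-(u+1+1) = u+i+j-(u+1) by omega] at e1
        rw [hdi, show u+i+j+1-(u+1) = i+j by omega]
        have hX := Nat.choose_succ_right_eq (u+i+j+1) (u+1+i)
        rw [show u+i+j+1 - (u+1+i) = j by omega] at hX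
        have hXY : (u+i+j+1+1).choose (u+1+i+1) = (u+i+j+1).choose (u+1+i) + (u+i+j+1).choose (u+1+i+1) :=
          Nat.choose_succ_succ _ _
        rw [hXY] at e1 ⊢
        rcases j with _ | j
        · have hx : (u+i+0+1).choose (u+1+i+1) = 0 := Nat.choose_eq_zero_of_lt (by omega)
          have hy : (u+i+0+1).choose (u+1+i) = 1 := by
            rw [show u+i+0+1 = u+1+i by omega]; exact Nat.choose_self _
          have h0 : (i+0).choose (i+1) = 0 := Nat.choose_eq_zero_of_lt (by omega)
          rw [hx, hy] at e1
          rw [hy, h0] at e3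
          rw [hx] at e4
          rw [hy] at e2
          rw [h0]
          clear hx hy h0 hX hXY ih ihd
          simp only [mul_zero, zero_mul, add_zero, mul_one] at e1 e2 e3 e4 hr ⊢
          have e3' : A (u+i+1) (u+1+i) u = 0 := by
            rcases Nat.mul_eq_zero.1 e3 with h | h
            · omega
            · exact h
          have e4' : A (u+i+1) (u+1+i+1) (u+1) = 0 := by
            rcases Nat.mul_eq_zero.1 e4 with h | h
            · omega
            · exact h
          rw [e3', e4'] at hr
          rcases i with _ | i
          · simp only [Nat.choose_zero_right, mul_one, add_zero] at e1 e2 hr ⊢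
            have a1 : A (u+1+1) (u+1+1) (u+1+1) = 1 := by
              apply Nat.eq_of_mul_eq_mul_left (show 0 < u+1+1 by omega); rw [e1, mul_one]
            have a2 : A (u+1) (u+1) (u+1) = 1 := by
              apply Nat.eq_of_mul_eq_mul_left (show 0 < u+1 by omega); rw [e2, mul_one]
            have a3 : A (u+1+1) (u+1+1) (u+1) = 0 := by omega
            rw [a3, mul_zero]
          · have h0 : (u+(i+1)-(u+1)).choose (i+1) = 0 := Nat.choose_eq_zero_of_lt (by omega)
            rw [h0] at e1 e2
            have a1 : A (u+(i+1)+1+1) (u+1+(i+1)+1) (u+1+1) = 0 := by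
              rcases Nat.mul_eq_zero.1 e1 with h | h
              · omega
              · exact h
            have a2 : A (u+(i+1)+1) (u+1+(i+1)) (u+1) = 0 := by
              rcases Nat.mul_eq_zero.1 e2 with h | h
              · omega
              · exact h
            rw [a1, a2] at hr
            simp at hr
            simp [hr]
        · have hP := Nat.choose_succ_right_eq (i+j) i
          rw [show i+j-i = j by omega] at hP
          have hPQ : (i+(j+1)).choose (i+1) = (i+j).choose i + (i+j).choose (i+1) :=
            Nat.choose_succ_succ _ _
          rw [hPQ] at e3 ⊢
          rw [show u+i+(j+1)-(u+1) = i+j by omega] at e1 e2 e4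
          generalize (i+j).choose i = Q at *
          generalize (i+j).choose (i+1) = P at *
          generalize (u+i+(j+1)+1).choose (u+1+i) = Y at *
          generalize (u+i+(j+1)+1).choose (u+1+i+1) = X at *
          generalize A (u+i+(j+1)+1+1) (u+1+i+1) (u+1) = a0 at *
          generalize A (u+i+(j+1)+1+1) (u+1+i+1) (u+1+1) = a1 at *
          generalize A (u+i+(j+1)+1) (u+1+i) (u+1) = a2 at *
          generalize A (u+i+(j+1)+1) (u+1+i) u = a3 at *
          generalize A (u+i+(j+1)+1) (u+1+i+1) (u+1) = a4 at *
          clear ih ihd hXY hPQ h1 h2 hd hdi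
          zify at *
          push_cast at *
          have hN : ((u:ℤ)+i+(j+1)+1) ≠ 0 := by positivity
          have ht : ((u:ℤ)+1+i+1) ≠ 0 := by positivity
          apply mul_left_cancel₀ hN
          apply mul_left_cancel₀ ht
          linear_combination ((u:ℤ)+1+i+1)*(u+i+(j+1)+1)*(u+i+(j+1)+1+1) * hr
            + ((u:ℤ)+1+i+1)*(u+i+(j+1)+1) * e1
            + ((u:ℤ)+1+i+1)*(u+i+(j+1)+1+1) * (e4 + e3 - e2)
            + (((u:ℤ)+1)*P + (u+i+(j+1)+1)*Q) * hX - (Y:ℤ)*(u+i+(j+1)+1+1) * hP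

theorem final (k t : ℕ) (ht : 1 ≤ t) (htk : t ≤ k) :
    k * ((T k).filter (fun r => blk k r = t)).card = k.choose t * k.choose (t-1) := by
  obtain ⟨k, rfl⟩ : ∃ m, k = m + 1 := ⟨k-1, by omega⟩
  obtain ⟨t, rfl⟩ : ∃ m, t = m + 1 := ⟨t-1, by omega⟩
  rw [total]
  have h := A_formula (k+1) (t+1) 1 (by omega) (by omega)
  simp only [Nat.add_sub_cancel, one_mul] at h ⊢
  have h1 := Nat.add_one_mul_choose_eq k t
  have h2 := Nat.add_one_mul_choose_eq (k+1) t
  apply Nat.eq_of_mul_eq_mul_left (show 0 < k+1+1 by omega)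
  calc (k+1+1) * ((k+1) * A (k+2) (t+1) 1) = (k+1) * ((k+1+1) * A (k+2) (t+1) 1) := by ring
    _ = (k+1+1).choose (t+1) * ((k+1) * k.choose t) := by rw [h]; ring
    _ = (k+1+1).choose (t+1) * (t+1) * (k+1).choose (t+1) := by rw [h1]; ring
    _ = _ := by rw [← h2]; ring
variable {k : ℕ}

theorem part_ne (P : Finpartition (univ : Finset (Fin k))) (i : Fin k) : (P.part i).Nonempty :=
  ⟨i, P.mem_part (mem_univ i)⟩

/-- minimum of the block -/
def mn (P : Finpartition (univ : Finset (Fin k))) (i : Fin k) : Fin k :=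
  (P.part i).min' (part_ne P i)

theorem mn_mem (P : Finpartition (univ : Finset (Fin k))) (i : Fin k) : mn P i ∈ P.part i :=
  min'_mem _ _

theorem mn_le (P : Finpartition (univ : Finset (Fin k))) {i j : Fin k} (h : j ∈ P.part i) :
    mn P i ≤ j := min'_le _ _ h

theorem mem_iff (P : Finpartition (univ : Finset (Fin k))) {i j : Fin k} :
    j ∈ P.part i ↔ P.part j = P.part i :=
  P.mem_part_iff_part_eq_part (mem_univ _) (mem_univ _)

theorem part_mn (P : Finpartition (univ : Finset (Fin k))) (i : Fin k) :
    P.part (mn P i) = P.part i := (mem_iff P).1 (mn_mem P i)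

theorem mn_eq_iff (P : Finpartition (univ : Finset (Fin k))) {i j : Fin k} :
    mn P i = mn P j ↔ P.part i = P.part j := by
  constructor
  · intro h; rw [← part_mn P i, h, part_mn]
  · intro h; unfold mn; simp only [h]

theorem mn_mn (P : Finpartition (univ : Finset (Fin k))) (i : Fin k) :
    mn P (mn P i) = mn P i := (mn_eq_iff P).2 (part_mn P i)

theorem mn_le_self (P : Finpartition (univ : Finset (Fin k))) (i : Fin k) :
    mn P i ≤ i := mn_le P (P.mem_part (mem_univ i))

theorem nc_iff (P : Finpartition (univ : Finset (Fin k))) :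
    IsNonCrossing P ↔ ∀ i j : Fin k, i < j → mn P j ≤ i → mn P j ≤ mn P i := by
  unfold IsNonCrossing
  constructor
  · intro h i j hij hji
    by_contra hlt
    push Not at hlt
    apply h
    have hne : mn P j ≠ i := by
      intro e
      have := mn_mn P j
      rw [e] at this
      rw [e, this] at hlt
      exact lt_irrefl _ hlt
    refine ⟨mn P i, mn P j, i, j, hlt, lt_of_le_of_ne hji hne, hij, P.part i,
      P.part_mem.2 (mem_univ _), P.part j, P.part_mem.2 (mem_univ _), ?_, mn_mem _ _,
      P.mem_part (mem_univ _), mn_mem _ _, P.mem_part (mem_univ _)⟩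
    intro e
    rw [(mn_eq_iff P).2 e] at hlt
    exact lt_irrefl _ hlt
  · rintro h ⟨a, b, c, d, hab, hbc, hcd, B1, h1, B2, h2, hne, ha, hc, hb, hd⟩
    have ea := P.part_eq_of_mem h1 ha
    have eb := P.part_eq_of_mem h2 hb
    have ec := P.part_eq_of_mem h1 hc
    have ed := P.part_eq_of_mem h2 hd
    have e1 : mn P a = mn P c := (mn_eq_iff P).2 (by rw [ea, ec])
    have e2 : mn P b = mn P d := (mn_eq_iff P).2 (by rw [eb, ed])
    have e3 : mn P c ≠ mn P d := fun e => hne (by rw [← ec, ← ed]; exact (mn_eq_iff P).1 e)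
    have l1 := mn_le_self P a
    have l2 := mn_le_self P b
    have k1 := h c d hcd (by omega)
    have k2 := h b c hbc (by omega)
    omega

/-- extension to the naturals -/
def ext (P : Finpartition (univ : Finset (Fin k))) (i : ℕ) : ℕ :=
  if h : i < k then (mn P ⟨i, h⟩ : ℕ) else 0

theorem ext_val (P : Finpartition (univ : Finset (Fin k))) (i : Fin k) :
    ext P i = mn P i := by simp [ext]

theorem ext_good (P : Finpartition (univ : Finset (Fin k))) (h : IsNonCrossing P) :
    Good k (ext P) := by
  rw [nc_iff] at h
  refine ⟨fun i hi => by simp [ext, hi], fun j hj => ?_⟩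
  have e := ext_val P ⟨j, hj⟩
  simp only at e
  rw [e, ext_val, mn_mn]
  refine ⟨mn_le_self P ⟨j, hj⟩, rfl, fun i hi hle => ?_⟩
  have e' := ext_val P ⟨i, hi.trans hj⟩
  simp only at e'
  rw [e']
  exact h ⟨i, hi.trans hj⟩ ⟨j, hj⟩ hi hle

theorem ext_blk (P : Finpartition (univ : Finset (Fin k))) : blk k (ext P) = P.parts.card := by
  unfold blk
  symm
  refine card_bij (fun B hB => (B.min' (P.nonempty_of_mem_parts hB) : Fin k).val) ?_ ?_ ?_
  · intro B hB
    have hm := B.min'_mem (P.nonempty_of_mem_parts hB)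
    have e := P.part_eq_of_mem hB hm
    simp only [mem_filter, mem_range]
    refine ⟨Fin.is_lt _, ?_⟩
    rw [ext_val]
    unfold mn
    simp only [e]
  · intro B hB C hC hBC
    have hm := B.min'_mem (P.nonempty_of_mem_parts hB)
    have hm' := C.min'_mem (P.nonempty_of_mem_parts hC)
    rw [← Fin.ext hBC] at hm'
    exact P.eq_of_mem_parts hB hC hm hm'
  · intro v hv
    simp only [mem_filter, mem_range] at hv
    refine ⟨P.part ⟨v, hv.1⟩, P.part_mem.2 (mem_univ _), ?_⟩
    have := ext_val P ⟨v, hv.1⟩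
    simp only at this
    exact this.symm.trans hv.2

theorem ext_inj {P Q : Finpartition (univ : Finset (Fin k))} (h : ext P = ext Q) : P = Q := by
  have hm : ∀ i, mn P i = mn Q i := by
    intro i
    apply Fin.ext
    rw [← ext_val, ← ext_val, h]
  have hp : ∀ i, P.part i = Q.part i := by
    intro i
    ext j
    rw [mem_iff, mem_iff, ← mn_eq_iff, ← mn_eq_iff, hm, hm]
  apply Finpartition.ext
  have key : ∀ R S : Finpartition (univ : Finset (Fin k)), (∀ i, R.part i = S.part i) →
      ∀ B ∈ R.parts, B ∈ S.parts := by
    intro R S hRS B hB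
    obtain ⟨x, hx⟩ := R.nonempty_of_mem_parts hB
    rw [← R.part_eq_of_mem hB hx, hRS]
    exact S.part_mem.2 (mem_univ _)
  ext B
  exact ⟨key P Q hp B, key Q P (fun i => (hp i).symm) B⟩

theorem ext_surj (r : ℕ → ℕ) (hr : Good k r) :
    ∃ P : Finpartition (univ : Finset (Fin k)), IsNonCrossing P ∧ ext P = r := by
  classical
  let s : Setoid (Fin k) := Setoid.ker (fun i : Fin k => r i)
  let P := Finpartition.ofSetoid s
  have hmem : ∀ i j : Fin k, j ∈ P.part i ↔ r i = r j := fun i j =>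
    Finpartition.mem_part_ofSetoid_iff_rel
  have hmn : ∀ i : Fin k, (mn P i : ℕ) = r i := by
    intro i
    obtain ⟨a, b, c⟩ := hr.2 i i.2
    apply le_antisymm
    · have : (⟨r i, by omega⟩ : Fin k) ∈ P.part i := (hmem _ _).2 b.symm
      exact mn_le P this
    · have := (hmem _ _).1 (mn_mem P i)
      rw [this]
      exact (hr.2 _ (Fin.is_lt _)).1
  refine ⟨P, ?_, ?_⟩
  · rw [nc_iff]
    intro i j hij h
    have := (hr.2 j j.2).2.2 i hij
    rw [Fin.le_def, hmn] at h ⊢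
    rw [hmn]
    exact this h
  · funext i
    by_cases h : i < k
    · have := ext_val P ⟨i, h⟩
      simp only at this
      rw [this, hmn]
    · simp [ext, h, hr.1 i (by omega)]
end NC

theorem stmt_14 (k t : ℕ) (ht : 1 ≤ t) (htk : t ≤ k) :
    k * Nat.card {P : Finpartition (Finset.univ : Finset (Fin k)) //
        P.parts.card = t ∧ IsNonCrossing P} =
      k.choose t * k.choose (t - 1) := by
  classical
  rw [← NC.final k t ht htk]
  congr 1
  rw [← Fintype.card_coe, ← Nat.card_eq_fintype_card]
  refine Nat.card_congr (Equiv.ofBijective (fun P => ⟨NC.ext P.1, ?_⟩) ⟨?_, ?_⟩)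
  · rw [Finset.mem_filter, NC.mem_T, NC.ext_blk]
    exact ⟨NC.ext_good P.1 P.2.2, P.2.1⟩
  · intro P Q h
    exact Subtype.ext (NC.ext_inj (congrArg Subtype.val h))
  · rintro ⟨r, hr⟩
    have hr' := hr
    rw [Finset.mem_filter, NC.mem_T] at hr'
    obtain ⟨P, hP, rfl⟩ := NC.ext_surj r hr'.1
    exact ⟨⟨P, by rw [← NC.ext_blk]; exact hr'.2, hP⟩, rfl⟩
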